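/- Let μ be a unit pure imaginary quaternion and let f ∈ 𝒮(ℝ²,ℍ) be a Schwartz function. Then for all (u,v) ∈ ℝ², L^{μ,μ}[∂²f/∂x∂y](u,v) = ∬_{ℝ²} μ ((a₁x − u)/b₁) K_{A₁}^{μ}(x,u) f(x,y) K_{A₂}^{μ}(y,v) ((a₂y − v)/b₂) μ dx dy. -/

import Mathlib

noncomputable section
open MeasureTheory Real
open scoped ENNReal

abbrev ℍ : Type := Quaternion ℝ

/-- `μ` is a unit pure imaginary quaternion: `Re μ = 0` and `μ² = −1`. -/
def UnitPureIm (μ : ℍ) : Prop := μ.re = 0 ∧ μ ^ 2 = -1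

/-- membership in the slice `ℍ(μ) = {x + μ y : x, y ∈ ℝ}`. -/
def InSlice (μ : ℍ) (q : ℍ) : Prop := ∃ x y : ℝ, q = (x : ℍ) + y • μ

/-- `exp (t μ)` for a unit pure imaginary quaternion `μ`. -/
def qexp (μ : ℍ) (t : ℝ) : ℍ := (Real.cos t : ℍ) + Real.sin t • μ

/-- `(2πbμ)^(−1/2) := (2π|b|)^(−1/2) exp(−sgn(b) μ π/4)`. -/
def invSqrtFactor (μ : ℍ) (b : ℝ) : ℍ :=
  (Real.sqrt (2 * π * |b|))⁻¹ • qexp μ (-(Real.sign b) * (π / 4))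

/-- QLCT kernel `K_B^μ(x,u)` for `B = [[a,b],[c,d]]` (the entry `c` does not occur). -/
def K (μ : ℍ) (a b d : ℝ) (x u : ℝ) : ℍ :=
  invSqrtFactor μ b * qexp μ (a * x ^ 2 / (2 * b) - x * u / b + d * u ^ 2 / (2 * b))

/-- two-sided QLCT `L^{μ,ν}_{B₁,B₂}[f]`. -/
def QLCT (μ ν : ℍ) (a₁ b₁ d₁ a₂ b₂ d₂ : ℝ) (f : ℝ × ℝ → ℍ) : ℝ × ℝ → ℍ :=
  fun w => ∫ p : ℝ × ℝ, K μ a₁ b₁ d₁ p.1 w.1 * f p * K ν a₂ b₂ d₂ p.2 w.2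

/-- weight `W_B^μ(t,τ)` for `B = [[a,b],[c,d]]`. -/
def W (μ : ℍ) (a b : ℝ) (t τ : ℝ) : ℍ :=
  invSqrtFactor μ b * qexp μ (a * τ * (τ - t) / b)

/-- spatial convolution `f ⊛^{μ,ν}_{B₁,B₂} g`. -/
def sconv (μ ν : ℍ) (a₁ b₁ a₂ b₂ : ℝ) (f g : ℝ × ℝ → ℍ) : ℝ × ℝ → ℍ :=
  fun w => ∫ τ : ℝ × ℝ,
    W μ a₁ b₁ w.1 τ.1 * f τ * g (w.1 - τ.1, w.2 - τ.2) * W ν a₂ b₂ w.2 τ.2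

section Kernel

variable {μ : ℍ}

lemma hasDerivAt_qexp (hμ : UnitPureIm μ) (t : ℝ) : HasDerivAt (qexp μ) (μ * qexp μ t) t := by
  have hcos : HasDerivAt (fun t : ℝ => Real.cos t • (1 : ℍ)) (-Real.sin t • (1 : ℍ)) t :=
    (Real.hasDerivAt_cos t).smul_const _
  have hsin : HasDerivAt (fun t : ℝ => Real.sin t • μ) (Real.cos t • μ) t :=
    (Real.hasDerivAt_sin t).smul_const _
  have hsq : μ * μ = -1 := by rw [← sq, hμ.2]
  have hqexp : qexp μ = fun t : ℝ => Real.cos t • (1 : ℍ) + Real.sin t • μ := by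
    funext s
    rw [qexp, ← Quaternion.coe_one, Quaternion.smul_coe, mul_one]
  rw [hqexp]
  refine (hcos.add hsin).congr_deriv ?_
  simp only [mul_add, mul_smul_comm, mul_one, hsq]
  rw [smul_neg, neg_smul, add_comm]

lemma commute_qexp (μ : ℍ) (t : ℝ) : Commute μ (qexp μ t) :=
  Commute.add_right (Quaternion.coe_commutes _ μ).symm ((Commute.refl μ).smul_right _)

lemma commute_K (μ : ℍ) (a b d x u : ℝ) : Commute μ (K μ a b d x u) :=
  ((commute_qexp μ _).smul_right _).mul_right (commute_qexp μ _)

lemma norm_qexp_le (μ : ℍ) (t : ℝ) : ‖qexp μ t‖ ≤ 1 + ‖μ‖ := by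
  refine (norm_add_le _ _).trans ?_
  rw [Quaternion.norm_coe, norm_smul]
  exact add_le_add (Real.abs_cos_le_one t)
    (mul_le_of_le_one_left (norm_nonneg _) (Real.abs_sin_le_one t))

lemma norm_K_le (μ : ℍ) (a b d x u : ℝ) :
    ‖K μ a b d x u‖ ≤ ‖invSqrtFactor μ b‖ * (1 + ‖μ‖) := by
  rw [K, norm_mul]
  exact mul_le_mul_of_nonneg_left (norm_qexp_le μ _) (norm_nonneg _)

/-- The derivative of the kernel `K` in its first variable. -/
def derivK (μ : ℍ) (a b d : ℝ) (x u : ℝ) : ℍ :=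
  ((a * x - u) / b) • μ * K μ a b d x u

lemma derivK_eq_mul_right (μ : ℍ) (a b d x u : ℝ) :
    derivK μ a b d x u = K μ a b d x u * (((a * x - u) / b) • μ) :=
  ((commute_K μ a b d x u).smul_left _).eq

lemma hasDerivAt_K (hμ : UnitPureIm μ) (a b d x u : ℝ) :
    HasDerivAt (fun x => K μ a b d x u) (derivK μ a b d x u) x := by
  have hphase : HasDerivAt
      (fun x : ℝ => a * x ^ 2 / (2 * b) - x * u / b + d * u ^ 2 / (2 * b))
      ((a * x - u) / b) x := by
    have h := (((((hasDerivAt_id x).pow 2).const_mul a).div_const (2 * b)).sub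
      (((hasDerivAt_id x).mul_const u).div_const b)).add_const (d * u ^ 2 / (2 * b))
    refine h.congr_deriv ?_
    simp only [id, Nat.cast_ofNat]
    ring
  refine (((hasDerivAt_qexp hμ _).scomp x hphase).const_mul (invSqrtFactor μ b)).congr_deriv ?_
  have hcomm : Commute μ (invSqrtFactor μ b) := (commute_qexp μ _).smul_right _
  rw [derivK, K, mul_smul_comm, smul_mul_assoc, ← mul_assoc, ← mul_assoc, hcomm.eq]

lemma continuous_K (hμ : UnitPureIm μ) (a b d u : ℝ) : Continuous (fun x => K μ a b d x u) :=
  continuous_iff_continuousAt.2 fun x => (hasDerivAt_K hμ a b d x u).continuousAt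

lemma continuous_derivK (hμ : UnitPureIm μ) (a b d u : ℝ) :
    Continuous (fun x => derivK μ a b d x u) :=
  Continuous.mul (by fun_prop) (continuous_K hμ a b d u)

end Kernel

section LinearGrowth

variable {E F : Type*} [NormedAddCommGroup E] [NormedAddCommGroup F]

/-- `A` is continuous and grows at most linearly at infinity. -/
structure LinearGrowth (A : E → F) : Prop where
  continuous : Continuous A
  exists_bound : ∃ C, 0 ≤ C ∧ ∀ p, ‖A p‖ ≤ C * (1 + ‖p‖)

lemma LinearGrowth.comp {G : Type*} [NormedAddCommGroup G] {A : E → F} (hA : LinearGrowth A)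
    {φ : G → E} (hφ : Continuous φ) (hφ_le : ∀ p, ‖φ p‖ ≤ ‖p‖) :
    LinearGrowth (fun p => A (φ p)) := by
  obtain ⟨C, hC, h⟩ := hA.exists_bound
  refine ⟨hA.continuous.comp hφ, C, hC, fun p => (h _).trans ?_⟩
  gcongr
  exact hφ_le p

lemma linearGrowth_K {μ : ℍ} (hμ : UnitPureIm μ) (a b d u : ℝ) :
    LinearGrowth (fun x => K μ a b d x u) := by
  refine ⟨continuous_K hμ a b d u, ‖invSqrtFactor μ b‖ * (1 + ‖μ‖), by positivity, fun x => ?_⟩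
  exact (norm_K_le μ a b d x u).trans
    (le_mul_of_one_le_right (by positivity) (by linarith [norm_nonneg x]))

lemma linearGrowth_derivK {μ : ℍ} (hμ : UnitPureIm μ) (a b d u : ℝ) :
    LinearGrowth (fun x => derivK μ a b d x u) := by
  refine ⟨continuous_derivK hμ a b d u,
    (|a| + |u|) / |b| * ‖μ‖ * (‖invSqrtFactor μ b‖ * (1 + ‖μ‖)), by positivity, fun x => ?_⟩
  have hnum : |a * x - u| ≤ (|a| + |u|) * (1 + |x|) := by
    refine (abs_sub _ _).trans ?_
    rw [abs_mul]
    nlinarith [abs_nonneg a, abs_nonneg u, abs_nonneg x, mul_nonneg (abs_nonneg u) (abs_nonneg x)]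
  rw [derivK, norm_mul, norm_smul, Real.norm_eq_abs, Real.norm_eq_abs, abs_div]
  calc |a * x - u| / |b| * ‖μ‖ * ‖K μ a b d x u‖
      ≤ (|a| + |u|) * (1 + |x|) / |b| * ‖μ‖ * (‖invSqrtFactor μ b‖ * (1 + ‖μ‖)) := by
        gcongr
        exact norm_K_le μ a b d x u
    _ = _ := by ring

lemma LinearGrowth.integrable_mul_mul {A B : ℝ × ℝ → ℍ} (hA : LinearGrowth A)
    (hB : LinearGrowth B) (g : SchwartzMap (ℝ × ℝ) ℍ) :
    Integrable (fun p => A p * g p * B p) := by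
  obtain ⟨C, hC, hAC⟩ := hA.exists_bound
  obtain ⟨D, hD, hBD⟩ := hB.exists_bound
  have hdom : Integrable (fun p : ℝ × ℝ =>
      C * D * (‖p‖ ^ 0 * ‖g p‖ + 2 * (‖p‖ ^ 1 * ‖g p‖) + ‖p‖ ^ 2 * ‖g p‖)) :=
    (((g.integrable_pow_mul volume 0).add ((g.integrable_pow_mul volume 1).const_mul 2)).add
      (g.integrable_pow_mul volume 2)).const_mul _
  refine hdom.mono'
    ((hA.continuous.mul g.continuous).mul hB.continuous).aestronglyMeasurable
    (Filter.Eventually.of_forall fun p => ?_)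
  rw [norm_mul, norm_mul]
  calc ‖A p‖ * ‖g p‖ * ‖B p‖ ≤ C * (1 + ‖p‖) * ‖g p‖ * (D * (1 + ‖p‖)) := by
        gcongr
        · exact hAC p
        · exact hBD p
    _ = _ := by ring

end LinearGrowth

section IntegrationByParts

open LineDeriv

lemma hasLineDerivAt_schwartzMap (g : SchwartzMap (ℝ × ℝ) ℍ) (p e : ℝ × ℝ) :
    HasLineDerivAt ℝ g (∂_{e} g p) p e :=
  (g.differentiableAt (x := p)).hasFDerivAt.hasLineDerivAt e

/-- Integration by parts in the first variable. -/
lemma integral_mul_lineDerivOp_fst_mul {k dk : ℝ → ℍ}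
    (hk : ∀ x, HasDerivAt k (dk x) x) (hk_growth : LinearGrowth k) (hdk_growth : LinearGrowth dk)
    {l : ℝ → ℍ} (hl_growth : LinearGrowth l) (g : SchwartzMap (ℝ × ℝ) ℍ) :
    ∫ p : ℝ × ℝ, k p.1 * ∂_{((1 : ℝ), (0 : ℝ))} g p * l p.2 =
      -∫ p : ℝ × ℝ, dk p.1 * g p * l p.2 := by
  have hfst {A : ℝ → ℍ} (hA : LinearGrowth A) : LinearGrowth (fun p : ℝ × ℝ => A p.1) :=
    hA.comp continuous_fst norm_fst_le
  have hl : LinearGrowth (fun p : ℝ × ℝ => l p.2) := hl_growth.comp continuous_snd norm_snd_le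
  have h := integral_bilinear_hasLineDerivAt_right_eq_neg_left_of_integrable
    (μ := (volume : Measure (ℝ × ℝ))) (B := ContinuousLinearMap.mul ℝ ℍ)
    (f := fun p => k p.1) (f' := fun p => dk p.1) (g := fun p => g p * l p.2)
    (g' := fun p => ∂_{((1 : ℝ), (0 : ℝ))} g p * l p.2) (v := ((1 : ℝ), (0 : ℝ)))
    (by simpa only [ContinuousLinearMap.mul_apply', mul_assoc] using
      (hfst hdk_growth).integrable_mul_mul hl g)
    (by simpa only [ContinuousLinearMap.mul_apply', mul_assoc] using
      (hfst hk_growth).integrable_mul_mul hl _)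
    (by simpa only [ContinuousLinearMap.mul_apply', mul_assoc] using
      (hfst hk_growth).integrable_mul_mul hl g)
    (fun p _ => by
      have := (hk (p.1 + 0)).comp_const_add p.1 0
      simpa [HasLineDerivAt] using this)
    (fun p _ => by
      have := HasDerivAt.mul_const (hasLineDerivAt_schwartzMap g p (1, 0)) (l p.2)
      simpa [HasLineDerivAt] using this)
  simpa only [ContinuousLinearMap.mul_apply', mul_assoc] using h

/-- Integration by parts in the second variable. -/
lemma integral_mul_lineDerivOp_snd_mul {k l dl : ℝ → ℍ}
    (hl : ∀ y, HasDerivAt l (dl y) y) (hk_growth : LinearGrowth k)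
    (hl_growth : LinearGrowth l) (hdl_growth : LinearGrowth dl) (g : SchwartzMap (ℝ × ℝ) ℍ) :
    ∫ p : ℝ × ℝ, k p.1 * ∂_{((0 : ℝ), (1 : ℝ))} g p * l p.2 =
      -∫ p : ℝ × ℝ, k p.1 * g p * dl p.2 := by
  have hk : LinearGrowth (fun p : ℝ × ℝ => k p.1) := hk_growth.comp continuous_fst norm_fst_le
  have hsnd {A : ℝ → ℍ} (hA : LinearGrowth A) : LinearGrowth (fun p : ℝ × ℝ => A p.2) :=
    hA.comp continuous_snd norm_snd_le
  have h := integral_bilinear_hasLineDerivAt_right_eq_neg_left_of_integrable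
    (μ := (volume : Measure (ℝ × ℝ))) (B := ContinuousLinearMap.mul ℝ ℍ)
    (f := fun p => k p.1 * g p) (f' := fun p => k p.1 * ∂_{((0 : ℝ), (1 : ℝ))} g p)
    (g := fun p => l p.2) (g' := fun p => dl p.2) (v := ((0 : ℝ), (1 : ℝ)))
    (hk.integrable_mul_mul (hsnd hl_growth) _)
    (hk.integrable_mul_mul (hsnd hdl_growth) g)
    (hk.integrable_mul_mul (hsnd hl_growth) g)
    (fun p _ => by
      have := HasDerivAt.const_mul (k p.1) (hasLineDerivAt_schwartzMap g p (0, 1))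
      simpa [HasLineDerivAt] using this)
    (fun p _ => by
      have := (hl (p.2 + 0)).comp_const_add p.2 0
      simpa [HasLineDerivAt] using this)
  simp only [ContinuousLinearMap.mul_apply'] at h
  rw [h, neg_neg]

end IntegrationByParts

theorem qlct_mixed_partial
    (μ : ℍ) (hμ : UnitPureIm μ)
    (a₁ b₁ c₁ d₁ a₂ b₂ c₂ d₂ : ℝ)
    (hA₁ : a₁ * d₁ - b₁ * c₁ = 1) (hA₂ : a₂ * d₂ - b₂ * c₂ = 1)
    (hb₁ : b₁ ≠ 0) (hb₂ : b₂ ≠ 0)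
    (f : SchwartzMap (ℝ × ℝ) ℍ) :
    ∀ u v : ℝ,
      QLCT μ μ a₁ b₁ d₁ a₂ b₂ d₂
        (fun w => fderiv ℝ (fun q => fderiv ℝ (⇑f) q (0, 1)) w (1, 0)) (u, v) =
      ∫ w : ℝ × ℝ,
        ((a₁ * w.1 - u) / b₁) • μ * K μ a₁ b₁ d₁ w.1 u * f w *
          K μ a₂ b₂ d₂ w.2 v * (((a₂ * w.2 - v) / b₂) • μ) := by
  intro u v
  have hx := integral_mul_lineDerivOp_fst_mul (fun x => hasDerivAt_K hμ a₁ b₁ d₁ x u)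
    (linearGrowth_K hμ a₁ b₁ d₁ u) (linearGrowth_derivK hμ a₁ b₁ d₁ u)
    (linearGrowth_K hμ a₂ b₂ d₂ v) (LineDeriv.lineDerivOp ((0 : ℝ), (1 : ℝ)) f)
  have hy := integral_mul_lineDerivOp_snd_mul (fun y => hasDerivAt_K hμ a₂ b₂ d₂ y v)
    (linearGrowth_derivK hμ a₁ b₁ d₁ u) (linearGrowth_K hμ a₂ b₂ d₂ v)
    (linearGrowth_derivK hμ a₂ b₂ d₂ v) f
  refine (hx.trans (neg_eq_iff_eq_neg.2 hy)).trans (integral_congr_ae (.of_forall fun p => ?_))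
  beta_reduce
  rw [derivK_eq_mul_right μ a₂, derivK, ← mul_assoc]
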